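/- With notation as above, the ideal A^c of Σ-piecewise polynomial functions vanishing on the boundary ∂C is, as a module over ℂ[D_1,…,D_n], isomorphic to the quotient of the free module with generators F_I indexed by cones I ∈ Σ whose relative interior lies in the interior of C, by the submodule generated by the relations D_i·F_I − F_{I∪{i}} whenever i∉I and I∪{i} ∈ Σ, and D_i·F_I whenever i∉I and I∪{i} ∉ Σ. -/

import Mathlib

open scoped BigOperators

/-- The simplicial cone spanned by the vectors `v i`, `i ∈ I`. -/
def coneOf {n r : ℕ} (v : Fin n → (Fin r → ℝ)) (I : Finset (Fin n)) : Set (Fin r → ℝ) :=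
  {x | ∃ a : Fin n → ℝ, (∀ i, 0 ≤ a i) ∧ (∀ i ∉ I, a i = 0) ∧ x = ∑ i, a i • v i}

/-- The relative interior of the simplicial cone spanned by `v i`, `i ∈ I`. -/
def coneRelInt {n r : ℕ} (v : Fin n → (Fin r → ℝ)) (I : Finset (Fin n)) :
    Set (Fin r → ℝ) :=
  {x | ∃ a : Fin n → ℝ, (∀ i ∈ I, 0 < a i) ∧ (∀ i ∉ I, a i = 0) ∧ x = ∑ i, a i • v i}

/-- The support `C` of the fan. -/
def fanSupport {n r : ℕ} (v : Fin n → (Fin r → ℝ)) (S : Finset (Finset (Fin n))) :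
    Set (Fin r → ℝ) :=
  ⋃ I ∈ S, coneOf v I

/-- The ring `A` of `Σ`-piecewise polynomial functions on `C`. -/
def piecewisePoly {n r : ℕ} (v : Fin n → (Fin r → ℝ)) (S : Finset (Finset (Fin n))) :
    Set ((fanSupport v S) → ℂ) :=
  {f | ∀ I ∈ S, ∃ p : MvPolynomial (Fin r) ℂ,
    ∀ x : fanSupport v S, (x : Fin r → ℝ) ∈ coneOf v I →
      f x = MvPolynomial.eval (fun k => ((x : Fin r → ℝ) k : ℂ)) p}

/-- The ideal `A^c ⊆ A` of piecewise polynomial functions vanishing on the boundary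
`∂C`. -/
def piecewisePolyC {n r : ℕ} (v : Fin n → (Fin r → ℝ)) (S : Finset (Finset (Fin n))) :
    Set ((fanSupport v S) → ℂ) :=
  {f | f ∈ piecewisePoly v S ∧
    ∀ x : fanSupport v S, (x : Fin r → ℝ) ∈ frontier (fanSupport v S) → f x = 0}

/-- Index type for the generators `F_I`: cones `I ∈ Σ` whose relative interior lies in the
interior of `C`. -/
def interiorCones {n r : ℕ} (v : Fin n → (Fin r → ℝ)) (S : Finset (Finset (Fin n))) :=
  {I : Finset (Fin n) // I ∈ S ∧ coneRelInt v I ⊆ interior (fanSupport v S)}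

open MvPolynomial

section Squarefree

variable {σ : Type*}

/-- The exponent of the squarefree monomial `∏ i ∈ I, X i`. -/
noncomputable def sqfreeExp (I : Finset σ) : σ →₀ ℕ :=
  Finsupp.indicator I fun _ _ => 1

theorem sqfreeExp_apply [DecidableEq σ] (I : Finset σ) (i : σ) :
    sqfreeExp I i = if i ∈ I then 1 else 0 := by
  simp [sqfreeExp, Finsupp.indicator_apply]

theorem sqfreeExp_support (I : Finset σ) : (sqfreeExp I).support = I := by
  classical
  ext i
  simp [sqfreeExp_apply]

theorem sqfreeExp_support_le (m : σ →₀ ℕ) : sqfreeExp m.support ≤ m := by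
  classical
  intro i
  rw [sqfreeExp_apply]
  split_ifs with h
  · exact Nat.one_le_iff_ne_zero.2 (Finsupp.mem_support_iff.1 h)
  · exact Nat.zero_le _

theorem sqfreeExp_insert [DecidableEq σ] {I : Finset σ} {i : σ} (hi : i ∉ I) :
    sqfreeExp (insert i I) = sqfreeExp I + Finsupp.single i 1 := by
  ext j
  by_cases h : i = j
  · subst h
    simp [sqfreeExp_apply, hi]
  · simp [sqfreeExp_apply, Ne.symm h]

theorem prod_X_eq_monomial (I : Finset σ) :
    (∏ i ∈ I, X i : MvPolynomial σ ℂ) = monomial (sqfreeExp I) 1 := by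
  classical
  rw [monomial_eq, Finsupp.prod, sqfreeExp_support, map_one, one_mul]
  exact Finset.prod_congr rfl fun i hi => by simp [sqfreeExp_apply, hi]

variable {M : Type*} [AddCommGroup M] [Module (MvPolynomial σ ℂ) M] [Module ℂ M]
  [IsScalarTower ℂ (MvPolynomial σ ℂ) M]

/-- The `ℂ`-linear map from polynomials sending a monomial `X ^ m` with support `I` to
`X ^ m / ∏ i ∈ I, X i` times `F I`. -/
noncomputable def divSqfree (F : Finset σ → M) : MvPolynomial σ ℂ →ₗ[ℂ] M :=
  (basisMonomials σ ℂ).constr ℂ fun m =>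
    monomial (m - sqfreeExp m.support) (1 : ℂ) • F m.support

theorem divSqfree_monomial (F : Finset σ → M) (m : σ →₀ ℕ) (c : ℂ) :
    divSqfree F (monomial m c) = monomial (m - sqfreeExp m.support) c • F m.support := by
  have h : monomial m c = c • basisMonomials σ ℂ m := by simp [smul_monomial]
  rw [h, map_smul, divSqfree, Module.Basis.constr_basis, ← smul_assoc, smul_monomial, smul_eq_mul,
    mul_one]

theorem divSqfree_monomial_add_single [DecidableEq σ] (F : Finset σ → M) (m : σ →₀ ℕ) (i : σ) (c : ℂ)
    (hF : i ∉ m.support → (X i : MvPolynomial σ ℂ) • F m.support = F (insert i m.support)) :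
    divSqfree F (monomial (m + Finsupp.single i 1) c) =
      (X i : MvPolynomial σ ℂ) • divSqfree F (monomial m c) := by
  have hle := sqfreeExp_support_le m
  have hs : (m + Finsupp.single i 1).support = insert i m.support := by
    ext j
    by_cases h : i = j
    · subst h; simp
    · simp [Ne.symm h]
  rw [divSqfree_monomial, divSqfree_monomial, hs]
  by_cases hi : i ∈ m.support
  · rw [Finset.insert_eq_of_mem hi, smul_smul, X, monomial_mul, one_mul,
      tsub_add_eq_add_tsub hle |>.symm, add_comm (Finsupp.single i 1)]
  · rw [sqfreeExp_insert hi, add_tsub_add_eq_tsub_right, ← hF hi, smul_smul, smul_smul, mul_comm]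

theorem divSqfree_mul_prod [DecidableEq σ] (F : Finset σ → M) (I : Finset σ)
    (hF : ∀ J, I ⊆ J → ∀ i ∉ J, (X i : MvPolynomial σ ℂ) • F J = F (insert i J))
    (p : MvPolynomial σ ℂ) :
    divSqfree F (p * ∏ i ∈ I, X i) = p • F I := by
  have key : ∀ (q : MvPolynomial σ ℂ) (i : σ),
      divSqfree F (q * X i * ∏ i ∈ I, X i) =
        (X i : MvPolynomial σ ℂ) • divSqfree F (q * ∏ i ∈ I, X i) := by
    intro q i
    rw [prod_X_eq_monomial]
    induction q using MvPolynomial.induction_on' with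
    | monomial u a =>
      have h : monomial u a * X i * monomial (sqfreeExp I) 1 =
          monomial (u + sqfreeExp I + Finsupp.single i 1) a := by
        rw [X, monomial_mul, monomial_mul, mul_one, mul_one, add_right_comm]
      rw [h, monomial_mul, mul_one]
      refine divSqfree_monomial_add_single F _ i a (hF _ ?_ i)
      intro j hj
      simp [sqfreeExp_apply, hj]
    | add p q hp hq => simp only [add_mul, map_add, smul_add, hp, hq]
  induction p using MvPolynomial.induction_on with
  | C a =>
    rw [prod_X_eq_monomial, C_mul_monomial, mul_one, divSqfree_monomial, sqfreeExp_support,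
      tsub_self, ← C_apply]
  | add p q hp hq => rw [add_mul, map_add, hp, hq, add_smul]
  | mul_X p i hp => rw [key, hp, smul_smul, mul_comm]

theorem divSqfree_eq_sum (F : Finset σ → M) (P : MvPolynomial σ ℂ) :
    divSqfree F P =
      ∑ m ∈ P.support, monomial (m - sqfreeExp m.support) (coeff m P) • F m.support := by
  conv_lhs => rw [P.as_sum]
  simp only [map_sum, divSqfree_monomial]

end Squarefree

theorem coeff_eq_zero_iff_eval_orthant {σ : Type*} [Fintype σ] (K : Finset σ)
    (P : MvPolynomial σ ℂ) :
    (∀ m : σ →₀ ℕ, m.support ⊆ K → coeff m P = 0) ↔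
      ∀ a : σ → ℝ, (∀ i, 0 ≤ a i) → (∀ i ∉ K, a i = 0) →
        eval (fun i => (a i : ℂ)) P = 0 := by
  classical
  constructor
  · intro h a _ ha
    rw [eval_eq]
    refine Finset.sum_eq_zero fun m _ => ?_
    by_cases hm : m.support ⊆ K
    · rw [h m hm, zero_mul]
    · obtain ⟨i, hi, hiK⟩ := Finset.not_subset.1 hm
      rw [Finset.prod_eq_zero hi, mul_zero]
      rw [ha i hiK, Complex.ofReal_zero, zero_pow (Finsupp.mem_support_iff.1 hi)]
  · intro h
    have hinj : Function.Injective ((↑) : K → σ) := Subtype.val_injective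
    have h0 : killCompl hinj P = 0 := by
      refine funext_set (fun _ => (fun t : ℝ => (t : ℂ)) '' Set.Ici 0) (fun _ => ?_) ?_
      · exact (Set.Ici_infinite 0).image Complex.ofReal_injective.injOn
      · intro x hx
        choose a ha hax using fun i => hx i trivial
        let b : σ → ℝ := fun i => if hi : i ∈ K then a ⟨i, hi⟩ else 0
        have hb := h b (fun i => by
          by_cases hi : i ∈ K
          · simpa [b, hi] using ha ⟨i, hi⟩
          · simp [b, hi]) (fun i hi => by simp [b, hi])
        rw [map_zero, ← hb]
        change (eval x).comp (killCompl hinj).toRingHom P = _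
        congr 1
        apply ringHom_ext
        · intro r
          simp [killCompl]
        · intro i
          by_cases hi : i ∈ K
          · have : (killCompl hinj) (X i : MvPolynomial σ ℂ) = X ⟨i, hi⟩ := by
              rw [← killCompl_rename_app (R := ℂ) hinj (X ⟨i, hi⟩), rename_X]
            simp [this, b, hi, ← hax]
          · simp [killCompl, b, hi]
    intro m hm
    have := coeff_killCompl hinj (p := P) (s := m.comapDomain _ hinj.injOn)
    rw [h0, coeff_zero, Finsupp.mapDomain_comapDomain _ hinj] at this
    · exact this.symm
    · intro i hi
      exact ⟨⟨i, hm hi⟩, rfl⟩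

section Geometry

variable {n r : ℕ} {v : Fin n → (Fin r → ℝ)} {S : Finset (Finset (Fin n))} {I J K : Finset (Fin n)}

theorem coneOf_eq_image (v : Fin n → (Fin r → ℝ)) (I : Finset (Fin n)) :
    coneOf v I = Fintype.linearCombination ℝ (fun i : I => v i) '' Set.Ici 0 := by
  ext x
  constructor
  · rintro ⟨a, ha, haI, rfl⟩
    refine ⟨fun i => a i, fun i => ha i, ?_⟩
    rw [Fintype.linearCombination_apply, Finset.sum_coe_sort I fun i => a i • v i]
    exact Finset.sum_subset (Finset.subset_univ _) fun i _ hi => by rw [haI i hi, zero_smul]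
  · rintro ⟨b, hb, rfl⟩
    refine ⟨fun i => if hi : i ∈ I then b ⟨i, hi⟩ else 0, fun i => ?_, fun i hi => by simp [hi], ?_⟩
    · dsimp only
      split_ifs with hi
      · exact hb ⟨i, hi⟩
      · exact le_rfl
    · rw [Fintype.linearCombination_apply, ← Finset.sum_subset (Finset.subset_univ I)
        fun i _ hi => by simp [hi], ← Finset.sum_coe_sort I]
      exact Finset.sum_congr rfl fun i _ => by simp

theorem isClosed_coneOf (h : LinearIndependent ℝ (fun i : I => v i)) :
    IsClosed (coneOf v I) := by
  rw [coneOf_eq_image]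
  refine (LinearMap.isClosedEmbedding_of_injective ?_).isClosedMap _ isClosed_Ici
  exact LinearMap.ker_eq_bot.2 (h.fintypeLinearCombination_injective)

theorem coneOf_mono (h : I ⊆ J) : coneOf v I ⊆ coneOf v J := by
  rintro x ⟨a, ha, haI, rfl⟩
  exact ⟨a, ha, fun i hi => haI i fun hI => hi (h hI), rfl⟩

theorem add_mem_coneOf {x y : Fin r → ℝ} (hx : x ∈ coneOf v I) (hy : y ∈ coneOf v I) :
    x + y ∈ coneOf v I := by
  obtain ⟨a, ha, haI, rfl⟩ := hx
  obtain ⟨b, hb, hbI, rfl⟩ := hy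
  refine ⟨a + b, fun i => add_nonneg (ha i) (hb i), fun i hi => ?_, ?_⟩
  · simp [haI i hi, hbI i hi]
  · simp [add_smul, Finset.sum_add_distrib]

theorem smul_mem_coneOf {x : Fin r → ℝ} {t : ℝ} (ht : 0 ≤ t) (hx : x ∈ coneOf v I) :
    t • x ∈ coneOf v I := by
  obtain ⟨a, ha, haI, rfl⟩ := hx
  refine ⟨t • a, fun i => mul_nonneg ht (ha i), fun i hi => ?_, ?_⟩
  · simp [haI i hi]
  · simp [Finset.smul_sum, mul_smul]

theorem coneRelInt_subset_coneOf : coneRelInt v I ⊆ coneOf v I := by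
  rintro x ⟨a, ha, haI, rfl⟩
  refine ⟨a, fun i => ?_, haI, rfl⟩
  by_cases hi : i ∈ I
  · exact (ha i hi).le
  · exact (haI i hi).ge

theorem coneRelInt_nonempty (v : Fin n → (Fin r → ℝ)) (I : Finset (Fin n)) :
    (coneRelInt v I).Nonempty :=
  ⟨_, fun i => if i ∈ I then 1 else 0, fun i hi => by simp [hi], fun i hi => by simp [hi], rfl⟩

theorem add_smul_mem_coneRelInt {x y : Fin r → ℝ} {t : ℝ} (ht : 0 < t) (hx : x ∈ coneOf v I)
    (hy : y ∈ coneRelInt v I) : x + t • y ∈ coneRelInt v I := by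
  obtain ⟨a, ha, haI, rfl⟩ := hx
  obtain ⟨b, hb, hbI, rfl⟩ := hy
  refine ⟨a + t • b, fun i hi => ?_, fun i hi => ?_, ?_⟩
  · exact add_pos_of_nonneg_of_pos (ha i) (mul_pos ht (hb i hi))
  · simp [haI i hi, hbI i hi]
  · simp [add_smul, Finset.sum_add_distrib, Finset.smul_sum, mul_smul]

theorem exists_sub_smul_mem_coneOf {x y : Fin r → ℝ} (hx : x ∈ coneRelInt v I)
    (hy : y ∈ coneOf v I) : ∃ ε : ℝ, 0 < ε ∧ x - ε • y ∈ coneOf v I := by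
  obtain ⟨a, ha, haI, rfl⟩ := hx
  obtain ⟨b, hb, hbI, rfl⟩ := hy
  have hev : ∀ i ∈ I, ∀ᶠ ε in nhdsWithin (0 : ℝ) (Set.Ioi 0), ε * b i < a i := by
    intro i hi
    have hc : Filter.Tendsto (fun ε : ℝ => ε * b i) (nhds 0) (nhds (0 * b i)) :=
      (continuous_id.mul continuous_const).tendsto 0
    rw [zero_mul] at hc
    exact nhdsWithin_le_nhds (hc.eventually_lt_const (ha i hi))
  obtain ⟨ε, hε, hpos⟩ := (((Filter.eventually_all_finset I).2 hev).and
    self_mem_nhdsWithin).exists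
  refine ⟨ε, hpos, a - ε • b, fun i => ?_, fun i hi => ?_, ?_⟩
  · by_cases hi : i ∈ I
    · exact sub_nonneg.2 (hε i hi).le
    · simp [haI i hi, hbI i hi]
  · simp [haI i hi, hbI i hi]
  · simp [sub_smul, Finset.sum_sub_distrib, Finset.smul_sum, mul_smul]

/-- Whether a relative interior point of a cone lies in the interior of the support depends only on
the cone, and this property passes to larger cones. -/
theorem coneRelInt_subset_interior (hind : ∀ I ∈ S, LinearIndependent ℝ (fun i : I => v i))
    (huniq : ∀ I ∈ S, ∀ J ∈ S, (coneRelInt v I ∩ coneOf v J).Nonempty → I ⊆ J)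
    (hJ : J ∈ S) (hIJ : I ⊆ J) {x : Fin r → ℝ} (hx : x ∈ coneRelInt v I)
    (hxC : x ∈ interior (fanSupport v S)) :
    coneRelInt v J ⊆ interior (fanSupport v S) := by
  intro z hz
  obtain ⟨t, htC, ht⟩ : ∃ t : ℝ, x + t • z ∈ interior (fanSupport v S) ∧ 0 < t := by
    have hc : Filter.Tendsto (fun t : ℝ => x + t • z) (nhds 0) (nhds (x + (0 : ℝ) • z)) :=
      (continuous_const.add (continuous_id.smul continuous_const)).tendsto 0
    rw [zero_smul, add_zero] at hc
    have := nhdsWithin_le_nhds (s := Set.Ioi 0) (hc (isOpen_interior.mem_nhds hxC))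
    exact (Filter.Eventually.and this self_mem_nhdsWithin).exists
  have hy := add_smul_mem_coneRelInt ht (coneOf_mono hIJ (coneRelInt_subset_coneOf hx)) hz
  set y := x + t • z
  have hstar : ∀ᶠ w in nhds y, ∃ K ∈ S, J ⊆ K ∧ w ∈ coneOf v K := by
    have h1 : ∀ᶠ w in nhds y, ∀ K ∈ S, y ∉ coneOf v K → w ∉ coneOf v K := by
      refine (Filter.eventually_all_finset S).2 fun K hK => ?_
      by_cases hyK : y ∈ coneOf v K
      · simp [hyK]
      · filter_upwards [(isClosed_coneOf (hind K hK)).isOpen_compl.mem_nhds hyK] with w hw _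
        exact hw
    filter_upwards [h1, mem_interior_iff_mem_nhds.1 htC] with w hw hwC
    obtain ⟨K, hK, hwK⟩ := Set.mem_iUnion₂.1 hwC
    exact ⟨K, hK, huniq J hJ K hK ⟨y, hy, by_contra fun h => hw K hK h hwK⟩, hwK⟩
  obtain ⟨ε, hε, hsub⟩ := exists_sub_smul_mem_coneOf hz (coneRelInt_subset_coneOf hy)
  have hcont : Continuous fun w => y + ε⁻¹ • (w - z) := by fun_prop
  have hc := hcont.tendsto z
  rw [sub_self, smul_zero, add_zero] at hc
  rw [mem_interior_iff_mem_nhds]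
  filter_upwards [hc hstar] with w hw
  obtain ⟨K, hK, hJK, hwK⟩ := hw
  refine Set.mem_iUnion₂.2 ⟨K, hK, ?_⟩
  have := add_mem_coneOf (smul_mem_coneOf hε.le hwK) (coneOf_mono hJK hsub)
  convert this using 1
  rw [smul_add, smul_inv_smul₀ hε.ne']
  abel

theorem exists_linear_coordinates (h : LinearIndependent ℝ (fun i : I => v i)) :
    ∃ l : Fin n → MvPolynomial (Fin r) ℂ, ∀ a : Fin n → ℝ, (∀ i ∉ I, a i = 0) →
      ∀ i, eval (fun k => (((∑ j, a j • v j) k : ℝ) : ℂ)) (l i) = a i := by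
  obtain ⟨g, hg⟩ := LinearMap.exists_leftInverse_of_injective
    (Fintype.linearCombination ℝ (fun i : I => v i))
    (LinearMap.ker_eq_bot.2 (h.fintypeLinearCombination_injective))
  refine ⟨fun i => if hi : i ∈ I then ∑ k, C ((g (Pi.single k 1) ⟨i, hi⟩ : ℝ) : ℂ) * X k else 0,
    fun a ha i => ?_⟩
  have hsum : ∑ j, a j • v j =
      Fintype.linearCombination ℝ (fun i : I => v i) (fun i => a i) := by
    rw [Fintype.linearCombination_apply, Finset.sum_coe_sort I fun i => a i • v i]
    exact (Finset.sum_subset (Finset.subset_univ _)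
      fun i _ hi => by rw [ha i hi, zero_smul]).symm
  have hga : g (∑ j, a j • v j) = fun i : I => a i := by
    rw [hsum, ← LinearMap.comp_apply, hg, LinearMap.id_apply]
  by_cases hi : i ∈ I
  · have h1 : g (∑ j, a j • v j) ⟨i, hi⟩ = a i := by rw [hga]
    rw [← h1]
    simp only [dif_pos hi]
    generalize ∑ j, a j • v j = x
    have h2 : x = ∑ k, x k • Pi.single k (1 : ℝ) := by
      ext k
      simp [Finset.sum_apply, Pi.single_apply]
    conv_rhs => rw [h2]
    simp [mul_comm]
  · simp [hi, ha i hi]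

end Geometry

section Courant

variable {n r : ℕ} {v : Fin n → (Fin r → ℝ)} {S : Finset (Finset (Fin n))}
  {D : Fin n → fanSupport v S → ℂ}

/-- The functions `D i` are the Courant functions: on each cone of the fan they are the coordinates
with respect to the generators of the cone. -/
def IsCourant (v : Fin n → (Fin r → ℝ)) (S : Finset (Finset (Fin n)))
    (D : Fin n → fanSupport v S → ℂ) : Prop :=
  ∀ x : fanSupport v S, ∀ I ∈ S, ∀ a : Fin n → ℝ,
    (∀ i, 0 ≤ a i) → (∀ i ∉ I, a i = 0) → ((x : Fin r → ℝ) = ∑ i, a i • v i) →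
    ∀ i, D i x = (a i : ℂ)

/-- A cone of the fan whose relative interior lies in the interior of the support. -/
def IsInteriorCone (v : Fin n → (Fin r → ℝ)) (S : Finset (Finset (Fin n)))
    (I : Finset (Fin n)) : Prop :=
  I ∈ S ∧ coneRelInt v I ⊆ interior (fanSupport v S)

theorem coneOf_subset_fanSupport {I : Finset (Fin n)} (hI : I ∈ S) :
    coneOf v I ⊆ fanSupport v S :=
  Set.subset_iUnion₂_of_subset I hI subset_rfl

theorem exists_mem_coneRelInt (hdc : ∀ I ∈ S, ∀ J ⊆ I, J ∈ S) {K : Finset (Fin n)} (hK : K ∈ S)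
    {x : Fin r → ℝ} (hx : x ∈ coneOf v K) : ∃ J ∈ S, J ⊆ K ∧ x ∈ coneRelInt v J := by
  classical
  obtain ⟨a, ha, haK, rfl⟩ := hx
  have hsub : Finset.univ.filter (fun i => a i ≠ 0) ⊆ K := fun i hi =>
    by_contra fun h => (Finset.mem_filter.1 hi).2 (haK i h)
  refine ⟨_, hdc K hK _ hsub, hsub, a, fun i hi => ?_, fun i hi => ?_, rfl⟩
  · exact (ha i).lt_of_ne' (Finset.mem_filter.1 hi).2
  · simpa using hi

namespace IsCourant

theorem subset_of_nonempty (hD : IsCourant v S D) {I J : Finset (Fin n)} (hI : I ∈ S) (hJ : J ∈ S)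
    (h : (coneRelInt v I ∩ coneOf v J).Nonempty) : I ⊆ J := by
  obtain ⟨x, hxI, b, hb, hbJ, hx⟩ := h
  have hxC := coneOf_subset_fanSupport hI (coneRelInt_subset_coneOf hxI)
  obtain ⟨a, ha, haI, hxa⟩ := hxI
  intro i hi
  by_contra hiJ
  have ha0 : ∀ i, 0 ≤ a i := fun i => by
    by_cases hi : i ∈ I
    · exact (ha i hi).le
    · exact (haI i hi).ge
  have h1 := hD ⟨x, hxC⟩ I hI a ha0 haI hxa i
  rw [hD ⟨x, hxC⟩ J hJ b hb hbJ hx i, hbJ i hiJ] at h1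
  exact (ha i hi).ne (Complex.ofReal_injective h1)

theorem coeff_eq_zero_iff (hD : IsCourant v S D) {K : Finset (Fin n)} (hK : K ∈ S)
    (P : MvPolynomial (Fin n) ℂ) :
    (∀ m : Fin n →₀ ℕ, m.support ⊆ K → coeff m P = 0) ↔
      ∀ x : fanSupport v S, (x : Fin r → ℝ) ∈ coneOf v K → eval (fun i => D i x) P = 0 := by
  rw [coeff_eq_zero_iff_eval_orthant]
  constructor
  · rintro h x ⟨a, ha, haK, hx⟩
    rw [funext (hD x K hK a ha haK hx)]
    exact h a ha haK
  · intro h a ha haK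
    have hx : ∑ i, a i • v i ∈ coneOf v K := ⟨a, ha, haK, rfl⟩
    rw [← funext (hD ⟨_, coneOf_subset_fanSupport hK hx⟩ K hK a ha haK rfl)]
    exact h _ hx

theorem eval_eq_zero_iff (hD : IsCourant v S D) (hdc : ∀ I ∈ S, ∀ J ⊆ I, J ∈ S)
    (P : MvPolynomial (Fin n) ℂ) :
    (∀ x, eval (fun i => D i x) P = 0) ↔
      ∀ m : Fin n →₀ ℕ, m.support ∈ S → coeff m P = 0 := by
  constructor
  · intro h m hm
    exact (hD.coeff_eq_zero_iff hm P).2 (fun x _ => h x) m subset_rfl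
  · intro h x
    obtain ⟨K, hK, hx⟩ := Set.mem_iUnion₂.1 x.2
    exact (hD.coeff_eq_zero_iff hK P).1 (fun m hm => h m (hdc K hK _ hm)) x hx

theorem isInteriorCone_of_subset (hD : IsCourant v S D)
    (hind : ∀ I ∈ S, LinearIndependent ℝ (fun i : I => v i)) {I J : Finset (Fin n)}
    (hI : IsInteriorCone v S I) (hJ : J ∈ S) (hIJ : I ⊆ J) : IsInteriorCone v S J := by
  obtain ⟨x, hx⟩ := coneRelInt_nonempty v I
  exact ⟨hJ, coneRelInt_subset_interior hind (fun _ hI _ hJ => hD.subset_of_nonempty hI hJ) hJ hIJ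
    hx (hI.2 hx)⟩

theorem isInteriorCone_of_mem (hD : IsCourant v S D)
    (hind : ∀ I ∈ S, LinearIndependent ℝ (fun i : I => v i)) {J : Finset (Fin n)} (hJ : J ∈ S)
    {x : Fin r → ℝ} (hx : x ∈ coneRelInt v J) (hxC : x ∈ interior (fanSupport v S)) :
    IsInteriorCone v S J :=
  ⟨hJ, coneRelInt_subset_interior hind (fun _ hI _ hJ => hD.subset_of_nonempty hI hJ) hJ
    subset_rfl hx hxC⟩

theorem mem_piecewisePoly_iff (hD : IsCourant v S D) (hdc : ∀ I ∈ S, ∀ J ⊆ I, J ∈ S)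
    (hind : ∀ I ∈ S, LinearIndependent ℝ (fun i : I => v i)) (f : fanSupport v S → ℂ) :
    f ∈ piecewisePoly v S ↔
      ∃ P : MvPolynomial (Fin n) ℂ, (fun x => eval (fun i => D i x) P) = f := by
  classical
  constructor
  · intro hf
    have hq : ∀ I, ∃ q : MvPolynomial (Fin n) ℂ, I ∈ S → ∀ x : fanSupport v S,
        (x : Fin r → ℝ) ∈ coneOf v I → f x = eval (fun i => D i x) q := by
      intro I
      by_cases hI : I ∈ S
      · obtain ⟨p, hp⟩ := hf I hI
        refine ⟨bind₁ (fun k => ∑ i, C ((v i k : ℝ) : ℂ) * X i) p, fun _ x hx => ?_⟩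
        rw [hp x hx, ← coe_aeval_eq_eval, ← coe_aeval_eq_eval]
        simp only [RingHom.coe_coe, aeval_bind₁]
        congr 2
        obtain ⟨a, ha, haI, hxa⟩ := hx
        funext k
        simp [hD x I hI a ha haI hxa, hxa, Finset.sum_apply, mul_comm]
      · exact ⟨0, fun h => absurd h hI⟩
    choose q hq using hq
    let P : MvPolynomial (Fin n) ℂ := ∑ I ∈ S, ∑ m ∈ (q I).support with m.support = I,
      monomial m (coeff m (q I))
    have hP : ∀ m : Fin n →₀ ℕ, m.support ∈ S → coeff m P = coeff m (q m.support) := by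
      intro m hm
      simp only [P, coeff_sum, coeff_monomial, Finset.sum_ite_eq', Finset.mem_filter]
      rw [Finset.sum_eq_single m.support]
      · by_cases h : m ∈ (q m.support).support
        · simp [h]
        · rw [notMem_support_iff.1 h]; simp
      · intro I _ hI
        simp [Ne.symm hI]
      · exact fun h => absurd hm h
    refine ⟨P, funext fun x => ?_⟩
    obtain ⟨K, hK, hx⟩ := Set.mem_iUnion₂.1 x.2
    rw [hq K hK x hx, ← sub_eq_zero, ← map_sub]
    refine (hD.coeff_eq_zero_iff hK _).1 (fun m hm => ?_) x hx
    have hmS := hdc K hK _ hm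
    rw [coeff_sub, hP m hmS, ← coeff_sub]
    refine (hD.coeff_eq_zero_iff hmS _).2 (fun y hy => ?_) m subset_rfl
    rw [map_sub, ← hq _ hmS y hy, ← hq K hK y (coneOf_mono hm hy), sub_self]
  · rintro ⟨P, rfl⟩ I hI
    obtain ⟨l, hl⟩ := exists_linear_coordinates (hind I hI)
    refine ⟨bind₁ l P, fun x ⟨a, ha, haI, hxa⟩ => ?_⟩
    beta_reduce
    rw [← coe_aeval_eq_eval, ← coe_aeval_eq_eval]
    simp only [RingHom.coe_coe, aeval_bind₁]
    congr 2
    funext i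
    rw [hD x I hI a ha haI hxa, hxa]
    exact (hl a haI i).symm

theorem eval_mem_piecewisePolyC_iff (hD : IsCourant v S D) (hdc : ∀ I ∈ S, ∀ J ⊆ I, J ∈ S)
    (hind : ∀ I ∈ S, LinearIndependent ℝ (fun i : I => v i)) (P : MvPolynomial (Fin n) ℂ) :
    (fun x => eval (fun i => D i x) P) ∈ piecewisePolyC v S ↔
      ∀ m : Fin n →₀ ℕ, m.support ∈ S → ¬ IsInteriorCone v S m.support → coeff m P = 0 := by
  constructor
  · rintro ⟨_, h⟩ m hm hmI
    refine (hD.coeff_eq_zero_iff hm P).2 (fun x hx => ?_) m subset_rfl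
    refine h x ⟨subset_closure x.2, fun hxC => hmI ?_⟩
    obtain ⟨J, hJ, hJm, hxJ⟩ := exists_mem_coneRelInt hdc hm hx
    exact hD.isInteriorCone_of_subset hind (hD.isInteriorCone_of_mem hind hJ hxJ hxC) hm hJm
  · refine fun h => ⟨(hD.mem_piecewisePoly_iff hdc hind _).2 ⟨P, rfl⟩, fun x hx => ?_⟩
    obtain ⟨K, hK, hxK⟩ := Set.mem_iUnion₂.1 x.2
    obtain ⟨J, hJ, -, hxJ⟩ := exists_mem_coneRelInt hdc hK hxK
    refine (hD.coeff_eq_zero_iff hJ P).1 (fun m hm => h m (hdc J hJ _ hm) fun hmI => hx.2 ?_) x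
      (coneRelInt_subset_coneOf hxJ)
    exact (hD.isInteriorCone_of_subset hind hmI hJ hm).2 hxJ

end IsCourant

/-- The evaluation `ℂ[D₁, …, Dₙ] → A`. -/
noncomputable def courantEval (D : Fin n → fanSupport v S → ℂ) :
    MvPolynomial (Fin n) ℂ →+* (fanSupport v S → ℂ) :=
  RingHom.pi fun x => eval fun i => D i x

theorem courantEval_apply (D : Fin n → fanSupport v S → ℂ) (p : MvPolynomial (Fin n) ℂ) :
    courantEval D p = fun x => eval (fun i => D i x) p := rfl

/-- The map from the free module on the interior cones to polynomials, with
`F_I ↦ ∏ i ∈ I, X i`. -/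
noncomputable def generatorMap (v : Fin n → (Fin r → ℝ)) (S : Finset (Finset (Fin n))) :
    (interiorCones v S →₀ MvPolynomial (Fin n) ℂ) →ₗ[MvPolynomial (Fin n) ℂ]
      MvPolynomial (Fin n) ℂ :=
  Finsupp.linearCombination (MvPolynomial (Fin n) ℂ)
    fun I : interiorCones v S => ∏ i ∈ I.1, X i

theorem generatorMap_single (I : interiorCones v S) (p : MvPolynomial (Fin n) ℂ) :
    generatorMap v S (Finsupp.single I p) = p * ∏ i ∈ I.1, X i := by
  simp [generatorMap]

open Classical in
/-- The class of the generator `F_I` in a quotient of the free module on the interior cones, extended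
by zero to all index sets. -/
noncomputable def generatorClass
    (N : Submodule (MvPolynomial (Fin n) ℂ) (interiorCones v S →₀ MvPolynomial (Fin n) ℂ))
    (I : Finset (Fin n)) : (interiorCones v S →₀ MvPolynomial (Fin n) ℂ) ⧸ N :=
  if h : IsInteriorCone v S I then N.mkQ (Finsupp.single ⟨I, h⟩ 1) else 0

theorem generatorClass_of_mem
    (N : Submodule (MvPolynomial (Fin n) ℂ) (interiorCones v S →₀ MvPolynomial (Fin n) ℂ))
    (I : interiorCones v S) : generatorClass N I.1 = N.mkQ (Finsupp.single I 1) :=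
  dif_pos I.2

theorem generatorClass_of_not
    (N : Submodule (MvPolynomial (Fin n) ℂ) (interiorCones v S →₀ MvPolynomial (Fin n) ℂ))
    {I : Finset (Fin n)} (h : ¬ IsInteriorCone v S I) : generatorClass N I = 0 :=
  dif_neg h

namespace IsCourant

theorem mkQ_eq_divSqfree (hD : IsCourant v S D) (hdc : ∀ I ∈ S, ∀ J ⊆ I, J ∈ S)
    (hind : ∀ I ∈ S, LinearIndependent ℝ (fun i : I => v i))
    (N : Submodule (MvPolynomial (Fin n) ℂ) (interiorCones v S →₀ MvPolynomial (Fin n) ℂ))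
    (hmem : ∀ (I J : interiorCones v S) (i : Fin n), i ∉ I.1 → J.1 = insert i I.1 →
      Finsupp.single I (X i) - Finsupp.single J 1 ∈ N)
    (hnot_mem : ∀ (I : interiorCones v S) (i : Fin n), i ∉ I.1 → insert i I.1 ∉ S →
      Finsupp.single I (X i) ∈ N)
    (y : interiorCones v S →₀ MvPolynomial (Fin n) ℂ) :
    N.mkQ y = divSqfree (generatorClass N) (generatorMap v S y) := by
  have hX : ∀ (I : interiorCones v S) (p : MvPolynomial (Fin n) ℂ),
      p • generatorClass N I.1 = N.mkQ (Finsupp.single I p) := by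
    intro I p
    rw [generatorClass_of_mem, ← map_smul, Finsupp.smul_single, smul_eq_mul, mul_one]
  have hF : ∀ I, IsInteriorCone v S I → ∀ J, I ⊆ J → ∀ i ∉ J,
      (X i : MvPolynomial (Fin n) ℂ) • generatorClass N J = generatorClass N (insert i J) := by
    intro I hI J hIJ i hi
    by_cases hJ : IsInteriorCone v S J
    · rw [hX ⟨J, hJ⟩]
      by_cases hiJ : insert i J ∈ S
      · have hK := hD.isInteriorCone_of_subset hind hJ hiJ (Finset.subset_insert i J)
        rw [generatorClass_of_mem N ⟨_, hK⟩, ← sub_eq_zero, ← map_sub, Submodule.mkQ_apply,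
          Submodule.Quotient.mk_eq_zero]
        exact hmem ⟨J, hJ⟩ ⟨_, hK⟩ i hi rfl
      · rw [generatorClass_of_not N fun h => hiJ h.1, Submodule.mkQ_apply,
          Submodule.Quotient.mk_eq_zero]
        exact hnot_mem ⟨J, hJ⟩ i hi hiJ
    · have hJS : J ∉ S := fun h => hJ (hD.isInteriorCone_of_subset hind hI h hIJ)
      have hiS : insert i J ∉ S := fun h => hJS (hdc _ h J (Finset.subset_insert i J))
      rw [generatorClass_of_not N hJ, generatorClass_of_not N fun h => hiS h.1, smul_zero]
  induction y using Finsupp.induction_linear with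
  | zero => simp
  | add f g hf hg => rw [map_add, map_add, map_add, hf, hg]
  | single I p =>
    rw [generatorMap_single, divSqfree_mul_prod _ _ (hF I.1 I.2), hX]

theorem exists_presentation (hD : IsCourant v S D) (hdc : ∀ I ∈ S, ∀ J ⊆ I, J ∈ S)
    (hind : ∀ I ∈ S, LinearIndependent ℝ (fun i : I => v i))
    (N : Submodule (MvPolynomial (Fin n) ℂ) (interiorCones v S →₀ MvPolynomial (Fin n) ℂ))
    (hN : ∀ y ∈ N, courantEval D (generatorMap v S y) = 0)
    (hmem : ∀ (I J : interiorCones v S) (i : Fin n), i ∉ I.1 → J.1 = insert i I.1 →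
      Finsupp.single I (X i) - Finsupp.single J 1 ∈ N)
    (hnot_mem : ∀ (I : interiorCones v S) (i : Fin n), i ∉ I.1 → insert i I.1 ∉ S →
      Finsupp.single I (X i) ∈ N) :
    ∃ ψ : ((interiorCones v S →₀ MvPolynomial (Fin n) ℂ) ⧸ N) → (fanSupport v S → ℂ),
      Function.Injective ψ ∧
      Set.range ψ = piecewisePolyC v S ∧
      (∀ a b, ψ (a + b) = ψ a + ψ b) ∧
      (∀ (p : MvPolynomial (Fin n) ℂ) a,
        ψ (p • a) = (fun x => MvPolynomial.eval (fun i => D i x) p) * ψ a) ∧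
      (∀ I : interiorCones v S,
        ψ (Submodule.Quotient.mk (Finsupp.single I (1 : MvPolynomial (Fin n) ℂ))) =
          fun x => ∏ i ∈ I.1, D i x) := by
  let L := (courantEval D).toSemilinearMap.comp (generatorMap v S)
  let ψ := N.liftQ L fun y hy => LinearMap.mem_ker.2 (hN y hy)
  have hψ : ∀ y, ψ (N.mkQ y) = courantEval D (generatorMap v S y) := fun y => rfl
  have hgen : ∀ I : interiorCones v S,
      ψ (generatorClass N I.1) = courantEval D (∏ i ∈ I.1, X i) := by
    intro I
    rw [generatorClass_of_mem, hψ, generatorMap_single, one_mul]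
  have hzero : ∀ P : MvPolynomial (Fin n) ℂ,
      courantEval D P = 0 ↔ ∀ m : Fin n →₀ ℕ, m.support ∈ S → coeff m P = 0 := by
    intro P
    rw [← hD.eval_eq_zero_iff hdc, funext_iff]
    rfl
  refine ⟨ψ, ?_, ?_, map_add ψ, fun p a => map_smulₛₗ ψ p a, fun I => ?_⟩
  · refine (injective_iff_map_eq_zero ψ).2 fun a ha => ?_
    obtain ⟨y, rfl⟩ := N.mkQ_surjective a
    rw [hψ, hzero] at ha
    rw [hD.mkQ_eq_divSqfree hdc hind N hmem hnot_mem, divSqfree_eq_sum]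
    refine Finset.sum_eq_zero fun m _ => ?_
    by_cases hm : m.support ∈ S
    · rw [ha m hm, map_zero, zero_smul]
    · rw [generatorClass_of_not N fun h => hm h.1, smul_zero]
  · ext f
    constructor
    · rintro ⟨a, rfl⟩
      obtain ⟨y, rfl⟩ := N.mkQ_surjective a
      rw [hψ, courantEval_apply, hD.eval_mem_piecewisePolyC_iff hdc hind]
      intro m hm hmI
      induction y using Finsupp.induction_linear with
      | zero => simp
      | add f g hf hg => rw [map_add, coeff_add, hf, hg, add_zero]
      | single I p =>
        rw [generatorMap_single, prod_X_eq_monomial, coeff_mul_monomial', if_neg]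
        intro hle
        refine hmI (hD.isInteriorCone_of_subset hind I.2 hm ?_)
        rw [← sqfreeExp_support I.1]
        exact Finsupp.support_mono hle
    · intro hf
      obtain ⟨P, rfl⟩ := (hD.mem_piecewisePoly_iff hdc hind f).1 hf.1
      rw [hD.eval_mem_piecewisePolyC_iff hdc hind] at hf
      refine ⟨divSqfree (generatorClass N) P, ?_⟩
      rw [divSqfree_eq_sum, map_sum, ← courantEval_apply]
      conv_rhs => rw [P.as_sum, map_sum]
      refine Finset.sum_congr rfl fun m _ => ?_
      by_cases hm : IsInteriorCone v S m.support
      · rw [map_smulₛₗ, hgen ⟨_, hm⟩, smul_eq_mul, ← map_mul, prod_X_eq_monomial, monomial_mul,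
          mul_one, tsub_add_cancel_of_le (sqfreeExp_support_le m)]
      · rw [generatorClass_of_not N hm, smul_zero, map_zero, eq_comm, hzero]
        intro k hk
        rw [coeff_monomial]
        split_ifs with h
        · subst h
          exact hf m hk hm
        · rfl
  · rw [← Submodule.mkQ_apply, hψ, generatorMap_single, one_mul, courantEval_apply]
    simp

end IsCourant

end Courant

/-- the module `A^c` over `ℂ[D₁,…,D_n]` is presented by generators `F_I`,
for `I ∈ Σ` with `σ_I° ⊆ C°`, modulo the relations `D_i·F_I − F_{I∪{i}}` (for `i ∉ I`,
`I∪{i} ∈ Σ`) and `D_i·F_I` (for `i ∉ I`, `I∪{i} ∉ Σ`); the identification sends `F_I` to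
`∏_{i∈I} D_i` and is semilinear over the evaluation `ℂ[D₁,…,D_n] → A`, `X_i ↦ D_i`,
where `D_i` is the Courant function of `v_i`. -/
theorem stmt1 {n r : ℕ} (v : Fin n → (Fin r → ℝ)) (S : Finset (Finset (Fin n)))
    (hdc : ∀ I ∈ S, ∀ J ⊆ I, J ∈ S) (hne : ∅ ∈ S)
    (hind : ∀ I ∈ S, LinearIndependent ℝ (fun i : I => v i))
    (hglue : ∀ I ∈ S, ∀ J ∈ S, coneOf v I ∩ coneOf v J = coneOf v (I ∩ J))
    (hfull : ∃ I ∈ S, I.card = r)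
    -- the Courant functions `D i`
    (D : Fin n → (fanSupport v S) → ℂ)
    (hD : ∀ x : fanSupport v S, ∀ I ∈ S, ∀ a : Fin n → ℝ,
      (∀ i, 0 ≤ a i) → (∀ i ∉ I, a i = 0) → ((x : Fin r → ℝ) = ∑ i, a i • v i) →
      ∀ i, D i x = (a i : ℂ)) :
    ∃ ψ : ((interiorCones v S →₀ MvPolynomial (Fin n) ℂ) ⧸
        Submodule.span (MvPolynomial (Fin n) ℂ)
          (({y | ∃ (I J : interiorCones v S) (i : Fin n), i ∉ I.1 ∧
              J.1 = insert i I.1 ∧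
              y = Finsupp.single I (MvPolynomial.X i) -
                Finsupp.single J (1 : MvPolynomial (Fin n) ℂ)} ∪
           {y | ∃ (I : interiorCones v S) (i : Fin n), i ∉ I.1 ∧
              insert i I.1 ∉ S ∧ y = Finsupp.single I (MvPolynomial.X i)}) :
            Set (interiorCones v S →₀ MvPolynomial (Fin n) ℂ))) →
        ((fanSupport v S) → ℂ),
      Function.Injective ψ ∧
      Set.range ψ = piecewisePolyC v S ∧
      (∀ a b, ψ (a + b) = ψ a + ψ b) ∧
      (∀ (p : MvPolynomial (Fin n) ℂ) a,
        ψ (p • a) = (fun x => MvPolynomial.eval (fun i => D i x) p) * ψ a) ∧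
      (∀ I : interiorCones v S,
        ψ (Submodule.Quotient.mk (Finsupp.single I (1 : MvPolynomial (Fin n) ℂ))) = fun x => ∏ i ∈ I.1, D i x) := by
  have hC : IsCourant v S D := hD
  have hsq : ∀ (I : interiorCones v S) (i : Fin n), i ∉ I.1 →
      generatorMap v S (Finsupp.single I (MvPolynomial.X i)) =
        ∏ j ∈ insert i I.1, MvPolynomial.X j := fun I i hi => by
    rw [generatorMap_single, Finset.prod_insert hi]
  refine hC.exists_presentation hdc hind _ (fun y hy => ?_)
    (fun I J i hi hJ => Submodule.subset_span (Or.inl ⟨I, J, i, hi, hJ, rfl⟩))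
    (fun I i hi hiS => Submodule.subset_span (Or.inr ⟨I, i, hi, hiS, rfl⟩))
  induction hy using Submodule.span_induction with
  | mem y hy =>
    rcases hy with ⟨I, J, i, hi, hJ, rfl⟩ | ⟨I, i, hi, hiS, rfl⟩
    · rw [map_sub, hsq I i hi, generatorMap_single, one_mul, hJ, sub_self, map_zero]
    · rw [hsq I i hi, prod_X_eq_monomial]
      refine funext ((hC.eval_eq_zero_iff hdc _).2 fun m hm => ?_)
      rw [MvPolynomial.coeff_monomial, if_neg]
      rintro rfl
      exact hiS (sqfreeExp_support (insert i I.1) ▸ hm)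
  | zero => rw [map_zero, map_zero]
  | add x y _ _ hx hy => rw [map_add, map_add, hx, hy, add_zero]
  | smul p x _ hx => rw [map_smul, smul_eq_mul, map_mul, hx, mul_zero]
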